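/- Let s : M → M be SO(3)-equivariant, i.e., s(z * R̄) = s(z) * R̄ for every z ∈ M and every block rotation R̄ arising from R ∈ SO(3). Fix real numbers α, σ, a point x ∈ M, and a rotation R ∈ SO(3), and let p be the standard Gaussian density on M. Assume that ε ↦ p(ε) • s(α • x + σ • ε) is integrable with respect to the volume measure on M. Then ∫ p(ε) • s(α • (x * R̄) + σ • ε) dε = (∫ p(ε) • s(α • x + σ • ε) dε) * R̄; that is, the Gaussian-noised expectation of an SO(3)-equivariant map is again SO(3)-equivariant. -/

import Mathlib

open Matrix MeasureTheory

/-- The block rotation `R̄ = fromBlocks R 0 0 1` of size `(3+d) × (3+d)` obtained from a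
`3 × 3` rotation `R`, reindexed to `Fin (3+d)`. -/
noncomputable def blockRot (d : ℕ) (R : Matrix (Fin 3) (Fin 3) ℝ) :
    Matrix (Fin (3 + d)) (Fin (3 + d)) ℝ :=
  Matrix.reindex finSumFinEquiv finSumFinEquiv
    (Matrix.fromBlocks R 0 0 (1 : Matrix (Fin d) (Fin d) ℝ))

/-- Lebesgue (volume) measure on `N × m` real matrices. -/
noncomputable instance matrixMeasureSpace (N m : ℕ) :
    MeasureSpace (Matrix (Fin N) (Fin m) ℝ) :=
  inferInstanceAs (MeasureSpace (Fin N → Fin m → ℝ))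

noncomputable instance matrixNormedAddCommGroup (N m : ℕ) :
    NormedAddCommGroup (Matrix (Fin N) (Fin m) ℝ) :=
  inferInstanceAs (NormedAddCommGroup (Fin N → Fin m → ℝ))

noncomputable instance matrixNormedSpace (N m : ℕ) : NormedSpace ℝ (Matrix (Fin N) (Fin m) ℝ) :=
  inferInstanceAs (NormedSpace ℝ (Fin N → Fin m → ℝ))

/-- The Frobenius norm of a real `N × m` matrix. -/
noncomputable def frobNorm {N m : ℕ} (A : Matrix (Fin N) (Fin m) ℝ) : ℝ :=
  Real.sqrt (∑ i, ∑ j, (A i j) ^ 2)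

/-- The standard Gaussian density `p(ε) = (2π)^(−N·m/2) · exp(−‖ε‖_F²/2)`. -/
noncomputable def gaussDensity {N m : ℕ} (A : Matrix (Fin N) (Fin m) ℝ) : ℝ :=
  (2 * Real.pi) ^ (-(N * m : ℝ) / 2) * Real.exp (-(frobNorm A) ^ 2 / 2)

lemma blockRot_mul_transpose (d : ℕ) (R : Matrix (Fin 3) (Fin 3) ℝ) (hR : R * Rᵀ = 1) :
    blockRot d R * (blockRot d R)ᵀ = 1 := by
  unfold blockRot
  simp only [Matrix.reindex_apply, Matrix.transpose_submatrix, Matrix.fromBlocks_transpose]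
  rw [Matrix.submatrix_mul_equiv, Matrix.fromBlocks_multiply]
  simp [hR]

lemma frobNorm_mul {N m : ℕ} (A : Matrix (Fin N) (Fin m) ℝ) (Q : Matrix (Fin m) (Fin m) ℝ)
    (hQ : Q * Qᵀ = 1) : frobNorm (A * Q) = frobNorm A := by
  have key : ∀ B : Matrix (Fin N) (Fin m) ℝ,
      ∑ i, ∑ j, (B i j) ^ 2 = (B * Bᵀ).trace := by
    intro B
    simp [Matrix.trace, Matrix.mul_apply, pow_two]
  unfold frobNorm
  rw [key, key, Matrix.transpose_mul, Matrix.mul_assoc, ← Matrix.mul_assoc Q, hQ, Matrix.one_mul]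

lemma mp_row {m : ℕ} (Q : Matrix (Fin m) (Fin m) ℝ) (hQ : Q * Qᵀ = 1) :
    MeasurePreserving (fun v : Fin m → ℝ => v ᵥ* Q) volume volume := by
  have h1 : Q.det * Q.det = 1 := by
    have := congrArg Matrix.det hQ
    simpa using this
  have h0 : Qᵀ.det ≠ 0 := by
    rw [Matrix.det_transpose]
    intro h
    rw [h] at h1
    norm_num at h1
  have habs : |Q.det| = 1 := by
    rcases mul_self_eq_one_iff.mp h1 with h | h <;> rw [h] <;> simp
  have hf : (fun v : Fin m → ℝ => v ᵥ* Q) = Matrix.toLin' Qᵀ := by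
    funext v
    simp [Matrix.mulVec_transpose]
  rw [hf]
  refine ⟨(LinearMap.continuous_of_finiteDimensional _).measurable, ?_⟩
  rw [Real.map_matrix_volume_pi_eq_smul_volume_pi h0, Matrix.det_transpose, abs_inv, habs]
  simp

lemma mp_mul {N m : ℕ} (Q : Matrix (Fin m) (Fin m) ℝ) (hQ : Q * Qᵀ = 1) :
    MeasurePreserving (fun A : Fin N → Fin m → ℝ => fun i => A i ᵥ* Q) volume volume :=
  volume_preserving_pi (fun _ => mp_row Q hQ)

/-- Right multiplication by an orthogonal matrix, on the function space. -/
noncomputable def rightMul (N : ℕ) {m : ℕ} (Q : Matrix (Fin m) (Fin m) ℝ) (hQ : Q * Qᵀ = 1) :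
    (Fin N → Fin m → ℝ) ≃L[ℝ] (Fin N → Fin m → ℝ) :=
  LinearEquiv.toContinuousLinearEquiv
  { toFun := fun A i => A i ᵥ* Q
    invFun := fun A i => A i ᵥ* Qᵀ
    map_add' := fun A B => by funext i; simp [Matrix.add_vecMul]
    map_smul' := fun c A => by funext i; simp [Matrix.smul_vecMul]
    left_inv := fun A => by funext i; simp [Matrix.vecMul_vecMul, hQ]
    right_inv := fun A => by
      funext i
      simp [Matrix.vecMul_vecMul, _root_.mul_eq_one_comm.mp hQ] }

lemma integral_aux {N m : ℕ} (Q : Matrix (Fin m) (Fin m) ℝ) (hQ : Q * Qᵀ = 1)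
    (f g : (Fin N → Fin m → ℝ) → (Fin N → Fin m → ℝ))
    (h : ∀ A, g (rightMul N Q hQ A) = rightMul N Q hQ (f A)) :
    ∫ A, g A = rightMul N Q hQ (∫ A, f A) := by
  have hm : MeasurePreserving (rightMul N Q hQ) volume volume := mp_mul Q hQ
  rw [← hm.integral_comp (rightMul N Q hQ).toHomeomorph.measurableEmbedding g]
  simp_rw [h]
  exact (rightMul N Q hQ).integral_comp_comm f

/-- If `s : M → M` is SO(3)-equivariant, i.e.
`s (z * R̄) = s z * R̄` for every `z` and every block rotation `R̄` arising from
`R ∈ SO(3)`, then the Gaussian-noised expectation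
`x ↦ ∫ p(ε) • s(α • x + σ • ε) dε` is again SO(3)-equivariant. -/
theorem integral_equivariant (N d : ℕ)
    (s : Matrix (Fin N) (Fin (3 + d)) ℝ → Matrix (Fin N) (Fin (3 + d)) ℝ)
    (hs : ∀ (z : Matrix (Fin N) (Fin (3 + d)) ℝ) (R : Matrix (Fin 3) (Fin 3) ℝ),
      R * Rᵀ = 1 → R.det = 1 → s (z * blockRot d R) = s z * blockRot d R)
    (α σ : ℝ) (x : Matrix (Fin N) (Fin (3 + d)) ℝ)
    (R : Matrix (Fin 3) (Fin 3) ℝ) (hR : R * Rᵀ = 1) (hdet : R.det = 1)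
    (hint : Integrable (fun ε => gaussDensity ε • s (α • x + σ • ε)) volume) :
    ∫ ε, gaussDensity ε • s (α • (x * blockRot d R) + σ • ε) =
      (∫ ε, gaussDensity ε • s (α • x + σ • ε)) * blockRot d R := by
  have hQ := blockRot_mul_transpose d R hR
  refine integral_aux (blockRot d R) hQ
    (fun ε : Matrix (Fin N) (Fin (3 + d)) ℝ => gaussDensity ε • s (α • x + σ • ε))
    (fun ε : Matrix (Fin N) (Fin (3 + d)) ℝ =>
      gaussDensity ε • s (α • (x * blockRot d R) + σ • ε)) ?_
  intro A
  have key : ∀ A : Matrix (Fin N) (Fin (3 + d)) ℝ,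
      gaussDensity (A * blockRot d R) •
        s (α • (x * blockRot d R) + σ • (A * blockRot d R)) =
      (gaussDensity A • s (α • x + σ • A)) * blockRot d R := by
    intro A
    have h2 : α • (x * blockRot d R) + σ • (A * blockRot d R)
        = (α • x + σ • A) * blockRot d R := by
      rw [Matrix.add_mul, Matrix.smul_mul, Matrix.smul_mul]
    rw [h2, hs _ R hR hdet, Matrix.smul_mul]
    unfold gaussDensity
    rw [frobNorm_mul _ _ hQ]
  exact key A
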